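/- arXiv:2507.17272 — 11 statements merged into one kernel-verified Lean document; each statement's English description precedes it below -/
import Mathlib

section
/- Let {a_k} be a sequence of nonnegative real numbers and let Γ > 0. If Γ·a_k² ≤ a_k − a_{k+1} for every k ∈ {0, 1, …, ℓ−1}, where ℓ ≥ 1 is a positive integer, then a_ℓ ≤ a_0 / (1 + ℓ·Γ·a_0) and a_ℓ < 1/(Γ·ℓ). -/
/-- A quadratic decrease `Γ x² ≤ x - y` propagates a harmonic bound from `x` to `y`. -/
lemma harmonic_bound_step {x y b c Γ : ℝ} (hΓ : 0 < Γ) (hx : 0 ≤ x) (hy : 0 ≤ y) (hb : 0 ≤ b)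
    (h : Γ * x ^ 2 ≤ x - y) (hc : x * c ≤ b) : y * (c + Γ * b) ≤ b := by
  have hxy : y * (1 + Γ * x) ≤ x := by
    have h₁ : y * (1 + Γ * x) ≤ (x - Γ * x ^ 2) * (1 + Γ * x) :=
      mul_le_mul_of_nonneg_right (by linarith) (by positivity)
    have h₂ : 0 ≤ Γ ^ 2 * x ^ 3 := by positivity
    linarith
  rcases hx.eq_or_lt with rfl | hx
  · have : y = 0 := by linarith
    simpa [this] using hb
  · refine le_of_mul_le_mul_left ?_ hx
    linarith [mul_le_mul_of_nonneg_left hc hy, mul_le_mul_of_nonneg_left hxy hb]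

/-- Lemma (Polyak): if `Γ a_k² ≤ a_k − a_{k+1}` for `k = 0, …, ℓ−1` with `a_k ≥ 0`
and `Γ > 0`, then `a_ℓ ≤ a_0 / (1 + ℓ Γ a_0) < 1/(Γ ℓ)`. -/
theorem frank_wolfe_rate_recursion (a : ℕ → ℝ) (Γ : ℝ) (hΓ : 0 < Γ)
    (ha : ∀ k, 0 ≤ a k) (ℓ : ℕ) (hℓ : 1 ≤ ℓ)
    (hrec : ∀ k < ℓ, Γ * (a k) ^ 2 ≤ a k - a (k + 1)) :
    a ℓ ≤ a 0 / (1 + (ℓ : ℝ) * Γ * a 0) ∧ a ℓ < 1 / (Γ * (ℓ : ℝ)) := by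
  have hbound : ∀ k ≤ ℓ, a k * (1 + (k : ℝ) * Γ * a 0) ≤ a 0 := by
    intro k
    induction k with
    | zero => simp
    | succ k ih =>
      intro hk
      have h := harmonic_bound_step hΓ (ha k) (ha (k + 1)) (ha 0) (hrec k hk) (ih (by omega))
      push_cast
      linarith
  have h0 := ha 0
  have hℓ' : (0 : ℝ) < ℓ := by exact_mod_cast hℓ
  have hden : 0 < 1 + (ℓ : ℝ) * Γ * a 0 := by positivity
  have hle : a ℓ ≤ a 0 / (1 + (ℓ : ℝ) * Γ * a 0) := (le_div_iff₀ hden).2 (hbound ℓ le_rfl)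
  refine ⟨hle, hle.trans_lt ?_⟩
  rw [div_lt_div_iff₀ hden (by positivity)]
  linarith
end

section
/- Let {a_k} and {b_k} be nonnegative sequences of real numbers, let A > 0, and set β_k = 2/(k+2). If a_{k+1} ≤ a_k − b_k·β_k + (A/2)·β_k² for all k = 0, 1, 2, …, and a_k ≤ b_k for all k, then a_k ≤ 2A/k for all k = 1, 2, …. -/
/-- Lemma (Beck): if `a_{k+1} ≤ a_k − b_k β_k + (A/2) β_k²` with `β_k = 2/(k+2)`,
`a_k, b_k ≥ 0`, `a_k ≤ b_k`, and `A > 0`, then `a_k ≤ 2A/k` for all `k ≥ 1`. -/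
theorem sequence_rate_values (a b : ℕ → ℝ) (A : ℝ) (hA : 0 < A)
    (ha : ∀ k, 0 ≤ a k) (hb : ∀ k, 0 ≤ b k)
    (hrec : ∀ k : ℕ,
      a (k + 1) ≤ a k - b k * (2 / ((k : ℝ) + 2)) + (A / 2) * (2 / ((k : ℝ) + 2)) ^ 2)
    (hab : ∀ k, a k ≤ b k) :
    ∀ k : ℕ, 1 ≤ k → a k ≤ 2 * A / (k : ℝ) := by
  have weighted : ∀ k : ℕ, (k : ℝ) * (k + 1) * a k ≤ 2 * A * k := by
    intro k
    induction k with
    | zero => simp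
    | succ k ih =>
      have hk : (0 : ℝ) < (k : ℝ) + 2 := by positivity
      have step : a (k + 1) ≤
          a k - a k * (2 / ((k : ℝ) + 2)) + (A / 2) * (2 / ((k : ℝ) + 2)) ^ 2 := by
        have := mul_le_mul_of_nonneg_right (hab k) (by positivity : 0 ≤ 2 / ((k : ℝ) + 2))
        linarith [hrec k]
      have scaled := mul_le_mul_of_nonneg_left step
        (by positivity : 0 ≤ ((k : ℝ) + 1) * (k + 2))
      have expand : ((k : ℝ) + 1) * (k + 2) *
          (a k - a k * (2 / ((k : ℝ) + 2)) + (A / 2) * (2 / ((k : ℝ) + 2)) ^ 2) =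
          k * (k + 1) * a k + 2 * A - 2 * A / (k + 2) := by
        field_simp
        ring
      have : 0 ≤ 2 * A / ((k : ℝ) + 2) := by positivity
      push_cast
      linarith
  intro k hk
  have hk' : (0 : ℝ) < k := by exact_mod_cast hk
  rw [le_div_iff₀ hk']
  have : ((k : ℝ) + 1) * a k ≤ 2 * A :=
    le_of_mul_le_mul_left (by linarith [weighted k]) hk'
  linarith [ha k]
end

section
/- Let {a_k} and {b_k} be nonnegative sequences of real numbers, let A > 0, and set β_k = 2/(k+2). If a_{k+1} ≤ a_k − b_k·β_k + (A/2)·β_k² for all k = 0, 1, 2, …, and a_k ≤ b_k for all k, then for every integer k ≥ 3, min{ b_ℓ : ℓ ∈ {⌊k/2⌋+2, …, k} } ≤ 8A/(k−2), where ⌊k/2⌋ denotes the greatest integer n with n ≤ k/2. -/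
/-- The standard `O(1/k)` rate: `a_{k+1} ≤ 2A/(k+2)`. -/
theorem sequence_succ_le_of_recursion {a b : ℕ → ℝ} {A : ℝ} (hA : 0 < A)
    (hrec : ∀ k : ℕ,
      a (k + 1) ≤ a k - b k * (2 / ((k : ℝ) + 2)) + (A / 2) * (2 / ((k : ℝ) + 2)) ^ 2)
    (hab : ∀ k, a k ≤ b k) (k : ℕ) : a (k + 1) ≤ 2 * A / ((k : ℝ) + 2) := by
  induction k with
  | zero =>
    have h := hrec 0
    have h0 := hab 0
    norm_num at h ⊢
    linarith
  | succ k ih =>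
    have h := hrec (k + 1)
    push_cast at h ⊢
    have hk : (0 : ℝ) ≤ k := k.cast_nonneg
    have hcontract : a (k + 1) - b (k + 1) * (2 / ((k : ℝ) + 1 + 2)) ≤
        2 * A / ((k : ℝ) + 2) * (1 - 2 / ((k : ℝ) + 1 + 2)) := by
      have hβ : 2 / ((k : ℝ) + 1 + 2) ≤ 1 := by
        rw [div_le_one (by positivity)]
        linarith
      have h1 := mul_le_mul_of_nonneg_right (hab (k + 1))
        (by positivity : 0 ≤ 2 / ((k : ℝ) + 1 + 2))
      have h2 := mul_le_mul_of_nonneg_right ih (sub_nonneg.2 hβ)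
      linarith
    have hbound : 2 * A / ((k : ℝ) + 2) * (1 - 2 / ((k : ℝ) + 1 + 2)) +
        A / 2 * (2 / ((k : ℝ) + 1 + 2)) ^ 2 ≤ 2 * A / ((k : ℝ) + 1 + 2) := by
      have heq : 2 * A / ((k : ℝ) + 1 + 2) - (2 * A / ((k : ℝ) + 2) * (1 - 2 / ((k : ℝ) + 1 + 2)) +
          A / 2 * (2 / ((k : ℝ) + 1 + 2)) ^ 2) =
          2 * A / (((k : ℝ) + 2) * ((k : ℝ) + 1 + 2) ^ 2) := by
        field_simp
        ring
      have : 0 ≤ 2 * A / (((k : ℝ) + 2) * ((k : ℝ) + 1 + 2) ^ 2) := by positivity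
      linarith
    linarith

/-- Summing the recursion over `[s, s + n)` when `b` is bounded below by `B` there. -/
theorem sequence_add_le_of_recursion {a b : ℕ → ℝ} {A B : ℝ} (hA : 0 < A) (hB : 0 ≤ B)
    (hrec : ∀ k : ℕ,
      a (k + 1) ≤ a k - b k * (2 / ((k : ℝ) + 2)) + (A / 2) * (2 / ((k : ℝ) + 2)) ^ 2)
    (s k n : ℕ) (hn : s + n ≤ k + 1) (hb : ∀ l, s ≤ l → l ≤ k → B ≤ b l) :
    a (s + n) + n * (B * (2 / ((k : ℝ) + 2))) ≤
      a s + 2 * A * (1 / ((s : ℝ) + 1) - 1 / ((s : ℝ) + n + 1)) := by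
  induction n with
  | zero => simp
  | succ n ih =>
    have ih := ih (by omega)
    have h := hrec (s + n)
    have hstep : B * (2 / ((k : ℝ) + 2)) ≤ b (s + n) * (2 / (((s + n : ℕ) : ℝ) + 2)) := by
      have hle : ((s + n : ℕ) : ℝ) ≤ k := by exact_mod_cast (by omega : s + n ≤ k)
      have hbl := hb (s + n) (by omega) (by omega)
      exact mul_le_mul hbl (by gcongr) (by positivity) (hB.trans hbl)
    rw [← add_assoc]
    push_cast at h hstep ⊢
    have hsq : A / 2 * (2 / ((s : ℝ) + n + 2)) ^ 2 ≤
        2 * A * (1 / ((s : ℝ) + n + 1) - 1 / ((s : ℝ) + (n + 1) + 1)) := by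
      have heq : 2 * A * (1 / ((s : ℝ) + n + 1) - 1 / ((s : ℝ) + (n + 1) + 1)) -
          A / 2 * (2 / ((s : ℝ) + n + 2)) ^ 2 =
          2 * A / (((s : ℝ) + n + 1) * ((s : ℝ) + n + 2) ^ 2) := by
        rw [show (s : ℝ) + (n + 1) + 1 = s + n + 2 by ring]
        field_simp
        ring
      have : 0 ≤ 2 * A / (((s : ℝ) + n + 1) * ((s : ℝ) + n + 2) ^ 2) := by positivity
      linarith
    linarith

/-- Lemma (Beck): if `a_{k+1} ≤ a_k − b_k β_k + (A/2) β_k²` with `β_k = 2/(k+2)`,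
`a_k, b_k ≥ 0`, `a_k ≤ b_k`, and `A > 0`, then for every `k ≥ 3`,
`min { b_ℓ : ℓ ∈ {⌊k/2⌋+2, …, k} } ≤ 8A/(k−2)`. -/
theorem sequence_rate_gap (a b : ℕ → ℝ) (A : ℝ) (hA : 0 < A)
    (ha : ∀ k, 0 ≤ a k) (hb : ∀ k, 0 ≤ b k)
    (hrec : ∀ k : ℕ,
      a (k + 1) ≤ a k - b k * (2 / ((k : ℝ) + 2)) + (A / 2) * (2 / ((k : ℝ) + 2)) ^ 2)
    (hab : ∀ k, a k ≤ b k) :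
    ∀ k : ℕ, 3 ≤ k → ∃ ℓ ∈ Finset.Icc (k / 2 + 2) k, b ℓ ≤ 8 * A / ((k : ℝ) - 2) := by
  intro k hk
  by_contra! hcon
  have hk3 : (3 : ℝ) ≤ k := by exact_mod_cast hk
  have hk2 : (0 : ℝ) < k - 2 := by linarith
  obtain ⟨n, hn⟩ : ∃ n, k / 2 + 2 + n = k + 1 := ⟨k - k / 2 - 1, by omega⟩
  have hsum := sequence_add_le_of_recursion hA (by positivity : 0 ≤ 8 * A / ((k : ℝ) - 2)) hrec
    (k / 2 + 2) k n hn.le fun l h1 h2 => (hcon l (Finset.mem_Icc.2 ⟨h1, h2⟩)).le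
  have hrate := sequence_succ_le_of_recursion hA hrec hab (k / 2 + 1)
  have hnonneg := ha (k / 2 + 2 + n)
  have hm : (k : ℝ) ≤ 2 * (k / 2 : ℕ) + 1 := by exact_mod_cast (by omega : k ≤ 2 * (k / 2) + 1)
  have hn2 : (k : ℝ) ≤ 2 * n + 2 := by exact_mod_cast (by omega : k ≤ 2 * n + 2)
  have hend : ((k / 2 : ℕ) : ℝ) + 2 + n = k + 1 := by exact_mod_cast hn
  generalize k / 2 = m at *
  push_cast at hsum hrate
  rw [hend, show (m : ℝ) + 2 + 1 = m + 3 by ring] at hsum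
  rw [show (m : ℝ) + 1 + 2 = m + 3 by ring] at hrate
  have hlower : 8 * A / ((k : ℝ) + 2) ≤ n * (8 * A / ((k : ℝ) - 2) * (2 / ((k : ℝ) + 2))) := by
    calc 8 * A / ((k : ℝ) + 2)
        = ((k : ℝ) - 2) / 2 * (8 * A / ((k : ℝ) - 2) * (2 / ((k : ℝ) + 2))) := by
          field_simp
      _ ≤ _ := by
          gcongr
          linarith
  have hupper : 4 * A / ((m : ℝ) + 3) ≤ 8 * A / ((k : ℝ) + 2) := by
    rw [div_le_div_iff₀ (by positivity) (by positivity)]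
    nlinarith
  have hpos : 0 < 2 * A * (1 / ((k : ℝ) + 1 + 1)) := by positivity
  have hsplit : 4 * A / ((m : ℝ) + 3) = 2 * A / ((m : ℝ) + 3) + 2 * A * (1 / ((m : ℝ) + 3)) := by
    ring
  linarith
end

section
/- Let C ⊆ ℝⁿ be a nonempty compact convex set, let f : ℝⁿ → ℝ be differentiable, and suppose f is star-convex on C with minimum value f* over C. Define ω(x) := min_{u∈C} ∇f(x)ᵀ(u − x). Then for every x ∈ C, 0 ≤ f(x) − f* ≤ |ω(x)| = −ω(x). -/
open Set
open scoped RealInnerProductSpace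

/-- If every chord of `f` issuing from `x` towards `y` lies above `f`, then the first-order
increment of `f` at `x` in the direction `y - x` is at most `f y - f x`. -/
theorem HasGradientAt.inner_sub_le_of_forall_le_chord {E : Type*} [NormedAddCommGroup E]
    [InnerProductSpace ℝ E] [CompleteSpace E] {f : E → ℝ} {g x y : E}
    (hf : HasGradientAt f g x)
    (h : ∀ l ∈ Icc (0 : ℝ) 1, f (l • y + (1 - l) • x) ≤ l * f y + (1 - l) * f x) :
    ⟪g, y - x⟫ ≤ f y - f x := by
  have hlim := (hf.hasFDerivAt.hasLineDerivAt (y - x)).tendsto_slope_zero_right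
  rw [InnerProductSpace.toDual_apply_apply] at hlim
  refine le_of_tendsto hlim ?_
  filter_upwards [Ioc_mem_nhdsGT (zero_lt_one' ℝ)] with t ht
  have hchord := h t ⟨ht.1.le, ht.2⟩
  have hpt : t • y + (1 - t) • x = x + t • (y - x) := by module
  rw [hpt] at hchord
  rw [smul_eq_mul, inv_mul_le_iff₀ ht.1]
  linarith

/-- If `f` is differentiable and star-convex on a nonempty compact convex set `C`,
with minimum value `f*` over `C`, and `ω(x) = min_{u ∈ C} ⟪∇f(x), u − x⟫`, then
for every `x ∈ C` we have `0 ≤ f(x) − f* ≤ |ω(x)| = −ω(x)`. -/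
theorem star_convex_gap_bound {n : ℕ}
    (C : Set (EuclideanSpace ℝ (Fin n)))
    (hCne : C.Nonempty) (hCcpt : IsCompact C) (hCcvx : Convex ℝ C)
    (f : EuclideanSpace ℝ (Fin n) → ℝ)
    (f' : EuclideanSpace ℝ (Fin n) → EuclideanSpace ℝ (Fin n))
    (hf : ∀ x, HasGradientAt f (f' x) x)
    (fstar : ℝ) (hfstar : IsLeast (f '' C) fstar)
    (hstar : ∀ xs ∈ C, (∀ y ∈ C, f xs ≤ f y) → ∀ x ∈ C, ∀ l ∈ Icc (0 : ℝ) 1,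
      f (l • xs + (1 - l) • x) ≤ l * f xs + (1 - l) * f x)
    (ω : EuclideanSpace ℝ (Fin n) → ℝ)
    (hω : ∀ x ∈ C, IsLeast ((fun u => ⟪f' x, u - x⟫) '' C) (ω x)) :
    ∀ x ∈ C, 0 ≤ f x - fstar ∧ f x - fstar ≤ |ω x| ∧ |ω x| = -ω x := by
  intro x hx
  obtain ⟨⟨xs, hxs, rfl⟩, hmin⟩ := hfstar
  have hle : ∀ y ∈ C, f xs ≤ f y := fun y hy => hmin (mem_image_of_mem f hy)
  have hgrad : ⟪f' x, xs - x⟫ ≤ f xs - f x :=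
    (hf x).inner_sub_le_of_forall_le_chord (hstar xs hxs hle x hx)
  have hgap : ω x ≤ ⟪f' x, xs - x⟫ := (hω x hx).2 ⟨xs, hxs, rfl⟩
  have hx_le := hle x hx
  have habs : |ω x| = -ω x := abs_of_nonpos (by linarith)
  exact ⟨by linarith, by linarith, habs⟩
end

section
/- Let C₁, …, C_m ⊆ ℝⁿ be nonempty closed sets, each star-shaped with respect to every point of their common intersection X* := ∩_{i=1}^m C_i ≠ ∅ (i.e., for every x* ∈ X*, every y ∈ C_i, and every λ ∈ [0,1], λx* + (1−λ)y ∈ C_i). Let ω₁, …, ω_m ≥ 0 with Σ_{i=1}^m ω_i = 1, and define f(x) := Σ_{i=1}^m ω_i · d_{C_i}(x)², where d_{C_i}(x) := inf_{y∈C_i} ‖x − y‖. Then for every x* ∈ X*, every x ∈ ℝⁿ, and every λ ∈ [0,1], f(λx* + (1−λ)x) ≤ λ·f(x*) + (1−λ)·f(x); in particular f is star-convex. -/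
open Set

/-- If every segment from `c` to a point of `s` stays in `s`, then moving `x` towards `c`
contracts its distance to `s`. -/
theorem infDist_smul_add_smul_le {E : Type*} [SeminormedAddCommGroup E] [NormedSpace ℝ E]
    {s : Set E} {c : E} (hs : s.Nonempty)
    (hstar : ∀ y ∈ s, ∀ l ∈ Icc (0 : ℝ) 1, l • c + (1 - l) • y ∈ s)
    (x : E) {l : ℝ} (hl : l ∈ Icc (0 : ℝ) 1) :
    Metric.infDist (l • c + (1 - l) • x) s ≤ (1 - l) * Metric.infDist x s := by
  have key : ∀ y ∈ s, Metric.infDist (l • c + (1 - l) • x) s ≤ (1 - l) * dist x y := by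
    intro y hy
    calc Metric.infDist (l • c + (1 - l) • x) s
        ≤ dist (l • c + (1 - l) • x) (l • c + (1 - l) • y) :=
          Metric.infDist_le_dist_of_mem (hstar y hy l hl)
      _ = (1 - l) * dist x y := by
          rw [dist_add_left, dist_smul₀, Real.norm_of_nonneg (sub_nonneg.2 hl.2)]
  rcases hl.2.eq_or_lt with rfl | hlt
  · obtain ⟨y, hy⟩ := hs
    simpa using key y hy
  · have hpos : 0 < 1 - l := sub_pos.2 hlt
    rw [← div_le_iff₀' hpos, Metric.le_infDist hs]
    intro y hy
    rw [div_le_iff₀' hpos]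
    exact key y hy

/-- Weighted sum of squared distances to closed sets that are star-shaped with
respect to every point of their common intersection is a star-convex function. -/
theorem weighted_sq_dist_star_convex {n m : ℕ}
    (C : Fin m → Set (EuclideanSpace ℝ (Fin n)))
    (hne : ∀ i, (C i).Nonempty) (hcl : ∀ i, IsClosed (C i))
    (hXne : (⋂ i, C i).Nonempty)
    (hstarshaped : ∀ i, ∀ xs ∈ ⋂ j, C j, ∀ y ∈ C i, ∀ l ∈ Icc (0 : ℝ) 1,
      l • xs + (1 - l) • y ∈ C i)
    (w : Fin m → ℝ) (hw : ∀ i, 0 ≤ w i) (hsum : ∑ i, w i = 1) :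
    ∀ xs ∈ ⋂ i, C i, ∀ x : EuclideanSpace ℝ (Fin n), ∀ l ∈ Icc (0 : ℝ) 1,
      (∑ i, w i * Metric.infDist (l • xs + (1 - l) • x) (C i) ^ 2) ≤
        l * (∑ i, w i * Metric.infDist xs (C i) ^ 2) +
          (1 - l) * (∑ i, w i * Metric.infDist x (C i) ^ 2) := by
  intro xs hxs x l hl
  rw [Finset.mul_sum, Finset.mul_sum, ← Finset.sum_add_distrib]
  refine Finset.sum_le_sum fun i _ => ?_
  have hdist : Metric.infDist xs (C i) = 0 := Metric.infDist_zero_of_mem (mem_iInter.1 hxs i)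
  have hsq : Metric.infDist (l • xs + (1 - l) • x) (C i) ^ 2 ≤
      (1 - l) * Metric.infDist x (C i) ^ 2 := by
    calc Metric.infDist (l • xs + (1 - l) • x) (C i) ^ 2
        ≤ ((1 - l) * Metric.infDist x (C i)) ^ 2 :=
          pow_le_pow_left₀ Metric.infDist_nonneg
            (infDist_smul_add_smul_le (hne i) (hstarshaped i xs hxs) x hl) 2
      _ = (1 - l) ^ 2 * Metric.infDist x (C i) ^ 2 := mul_pow _ _ _
      _ ≤ (1 - l) * Metric.infDist x (C i) ^ 2 := by
          gcongr
          nlinarith [hl.1, hl.2]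
  calc w i * Metric.infDist (l • xs + (1 - l) • x) (C i) ^ 2
      ≤ w i * ((1 - l) * Metric.infDist x (C i) ^ 2) := mul_le_mul_of_nonneg_left hsq (hw i)
    _ = l * (w i * Metric.infDist xs (C i) ^ 2) +
        (1 - l) * (w i * Metric.infDist x (C i) ^ 2) := by
          rw [hdist]
          ring
end

section
/- Let C ⊆ ℝⁿ be a nonempty compact convex set with diameter diam(C), let f : ℝⁿ → ℝ be differentiable with ∇f L-Lipschitz continuous on C, and set ρ := sup_{x∈C} ‖∇f(x)‖. Fix ζ ∈ (0,1) and β ∈ (0,1), and define γ := min{ 1/(ρ·diam(C)), 2(1−ζ)/(β·L·diam(C)²) }. Let x ∈ C with ω(x) := min_{u∈C} ∇f(x)ᵀ(u−x) < 0, let p ∈ C attain this minimum, and set d := p − x. Suppose λ ∈ (0,1] is a stepsize accepted by the Armijo backtracking rule, i.e., either λ = 1, or f(x + βλ·d) > f(x) + ζ·βλ·ω(x) (the trial stepsize βλ was rejected). Then λ ≥ γ·|ω(x)|. -/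
open Set Metric
open scoped RealInnerProductSpace

/-- The descent lemma: along a direction `d`, a function whose gradient is `L`-Lipschitz on a convex
set containing `x` and `x + d` lies below its quadratic upper model at `x`. -/
theorem le_quadratic_model_of_gradient_lipschitz {E : Type*} [NormedAddCommGroup E]
    [InnerProductSpace ℝ E] [CompleteSpace E] {C : Set E} (hC : Convex ℝ C) {f : E → ℝ} {f' : E → E}
    (hf : ∀ x ∈ C, HasGradientAt f (f' x) x) {L : ℝ}
    (hLip : ∀ x ∈ C, ∀ y ∈ C, ‖f' x - f' y‖ ≤ L * ‖x - y‖)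
    {x d : E} (hx : x ∈ C) (hxd : x + d ∈ C) {t : ℝ} (ht : t ∈ Icc (0 : ℝ) 1) :
    f (x + t • d) ≤ f x + t * ⟪f' x, d⟫ + L / 2 * t ^ 2 * ‖d‖ ^ 2 := by
  have hmem : ∀ s ∈ Icc (0 : ℝ) 1, x + s • d ∈ C := fun s hs => hC.add_smul_mem hx hxd hs
  have hderiv : ∀ s ∈ Icc (0 : ℝ) 1,
      HasDerivAt (fun s : ℝ => f (x + s • d) - s * ⟪f' x, d⟫ - L / 2 * s ^ 2 * ‖d‖ ^ 2)
        (⟪f' (x + s • d), d⟫ - ⟪f' x, d⟫ - L * s * ‖d‖ ^ 2) s := by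
    intro s hs
    have hline : HasDerivAt (fun s : ℝ => x + s • d) d s := by
      simpa using ((hasDerivAt_id s).smul_const d).const_add x
    have hcomp : HasDerivAt (fun s : ℝ => f (x + s • d)) ⟪f' (x + s • d), d⟫ s := by
      simpa [Function.comp_def] using
        (hf _ (hmem s hs)).hasFDerivAt.comp_hasDerivAt s hline
    refine ((hcomp.sub ((hasDerivAt_id s).mul_const ⟪f' x, d⟫)).sub
      ((((hasDerivAt_id s).pow 2).const_mul (L / 2)).mul_const (‖d‖ ^ 2))).congr_deriv ?_
    norm_num only [id]
    ring
  have hanti : AntitoneOn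
      (fun s : ℝ => f (x + s • d) - s * ⟪f' x, d⟫ - L / 2 * s ^ 2 * ‖d‖ ^ 2) (Icc 0 1) := by
    refine antitoneOn_of_deriv_nonpos (convex_Icc 0 1)
      (fun s hs => (hderiv s hs).continuousAt.continuousWithinAt)
      (fun s hs => (hderiv s (interior_subset hs)).differentiableAt.differentiableWithinAt)
      (fun s hs => ?_)
    have hs' := interior_subset hs
    rw [(hderiv s hs').deriv, ← inner_sub_left]
    have hgrad : ‖f' (x + s • d) - f' x‖ ≤ L * (s * ‖d‖) := by
      simpa [norm_smul, abs_of_nonneg hs'.1] using hLip _ (hmem s hs') x hx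
    have hinner := real_inner_le_norm (f' (x + s • d) - f' x) d
    nlinarith [mul_le_mul_of_nonneg_right hgrad (norm_nonneg d)]
  have h := hanti (left_mem_Icc.2 zero_le_one) ht ht.1
  simp only [zero_smul, add_zero] at h
  linarith

/-- Lower bound on the Armijo backtracking stepsize for the Frank–Wolfe method:
any accepted stepsize `λ ∈ (0,1]` (either `λ = 1`, or the trial stepsize `βλ`
was rejected by the Armijo test) satisfies `λ ≥ γ |ω(x)|`, where
`γ = min{1/(ρ diam C), 2(1−ζ)/(β L diam C²)}` and `ρ = sup_{x∈C} ‖∇f(x)‖`. -/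
theorem armijo_stepsize_lower_bound {n : ℕ}
    (C : Set (EuclideanSpace ℝ (Fin n)))
    (hCne : C.Nonempty) (hCcpt : IsCompact C) (hCcvx : Convex ℝ C)
    (f : EuclideanSpace ℝ (Fin n) → ℝ)
    (f' : EuclideanSpace ℝ (Fin n) → EuclideanSpace ℝ (Fin n))
    (hf : ∀ x, HasGradientAt f (f' x) x)
    (L : ℝ) (hL : 0 < L)
    (hLip : ∀ x ∈ C, ∀ y ∈ C, ‖f' x - f' y‖ ≤ L * ‖x - y‖)
    (ρ : ℝ) (hρ : IsLUB ((fun x => ‖f' x‖) '' C) ρ)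
    (ζ β : ℝ) (hζ : ζ ∈ Ioo (0 : ℝ) 1) (hβ : β ∈ Ioo (0 : ℝ) 1)
    (γ : ℝ)
    (hγ : γ = min (1 / (ρ * diam C)) (2 * (1 - ζ) / (β * L * diam C ^ 2)))
    (x : EuclideanSpace ℝ (Fin n)) (hx : x ∈ C)
    (p : EuclideanSpace ℝ (Fin n)) (hp : p ∈ C)
    (hpmin : ∀ u ∈ C, ⟪f' x, p - x⟫ ≤ ⟪f' x, u - x⟫)
    (ω : ℝ) (hωdef : ω = ⟪f' x, p - x⟫) (hω : ω < 0)
    (lam : ℝ) (hlam : lam ∈ Ioc (0 : ℝ) 1)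
    (haccept : lam = 1 ∨
      f (x + (β * lam) • (p - x)) > f x + ζ * (β * lam) * ω) :
    lam ≥ γ * |ω| := by
  have hd : ‖p - x‖ ≤ diam C := by
    simpa [dist_eq_norm] using dist_le_diam_of_mem hCcpt.isBounded hp hx
  have hgrad : ‖f' x‖ ≤ ρ := hρ.1 (mem_image_of_mem _ hx)
  have hωρ : |ω| ≤ ρ * diam C := by
    rw [hωdef]
    exact (abs_real_inner_le_norm _ _).trans
      (mul_le_mul hgrad hd (norm_nonneg _) ((norm_nonneg _).trans hgrad))
  have hω0 : 0 < |ω| := abs_pos.2 hω.ne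
  have hρD : 0 < ρ * diam C := hω0.trans_le hωρ
  have hD : 0 < diam C :=
    lt_of_le_of_ne diam_nonneg fun h => by simp [← h] at hρD
  obtain ⟨hlam0, hlam1⟩ := hlam
  rcases haccept with rfl | hrej
  · calc γ * |ω| ≤ 1 / (ρ * diam C) * |ω| := by
          rw [hγ]; gcongr; exact min_le_left _ _
      _ ≤ 1 := by rwa [one_div_mul_eq_div, div_le_one hρD]
  · have hβL : 0 < β * L * diam C ^ 2 := mul_pos (mul_pos hβ.1 hL) (pow_pos hD 2)
    have ht0 : 0 < β * lam := mul_pos hβ.1 hlam0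
    have hdesc := le_quadratic_model_of_gradient_lipschitz hCcvx (fun y _ => hf y) hLip hx
      (d := p - x) (by simpa using hp) ⟨ht0.le, mul_le_one₀ hβ.2.le hlam0.le hlam1⟩
    rw [← hωdef] at hdesc
    have hmodel : L / 2 * (β * lam) ^ 2 * ‖p - x‖ ^ 2 ≤ L / 2 * (β * lam) ^ 2 * diam C ^ 2 := by
      gcongr
    have hstep : 2 * (1 - ζ) * |ω| ≤ lam * (β * L * diam C ^ 2) := by
      rw [abs_of_neg hω]
      refine le_of_mul_le_mul_left ?_ ht0
      linarith
    calc γ * |ω| ≤ 2 * (1 - ζ) / (β * L * diam C ^ 2) * |ω| := by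
          rw [hγ]; gcongr; exact min_le_right _ _
      _ ≤ lam := by rwa [div_mul_eq_mul_div, div_le_iff₀ hβL]
end

section
/- Let C ⊆ ℝⁿ be a nonempty compact convex set with diameter diam(C), let f : ℝⁿ → ℝ be differentiable with ∇f L-Lipschitz continuous on C, and suppose f is star-convex on C with minimum value f*. Set ρ := sup_{x∈C} ‖∇f(x)‖, fix ζ, β ∈ (0,1), and let γ := min{1/(ρ·diam(C)), 2(1−ζ)/(β·L·diam(C)²)}. Let {x^k} ⊆ C, {p^k} ⊆ C, and {λ_k} ⊆ (0,1] be sequences such that for every k: p^k minimizes u ↦ ∇f(x^k)ᵀ(u − x^k) over C with optimal value ω_k := ∇f(x^k)ᵀ(p^k − x^k) < 0; x^{k+1} = x^k + λ_k(p^k − x^k); the Armijo descent condition f(x^{k+1}) ≤ f(x^k) − ζ·λ_k·|ω_k| holds; and λ_k ≥ γ·|ω_k|. Then f(x^k) − f* ≤ 1/(ζ·γ·k) for all k = 1, 2, …. -/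
open Set Metric
open scoped RealInnerProductSpace

/-- A function lying below its chord from `x` to `y` satisfies the first-order inequality
at `x` in the direction `y - x`. -/
theorem inner_gradient_le_sub_of_le_chord {E : Type*} [NormedAddCommGroup E]
    [InnerProductSpace ℝ E] [CompleteSpace E] {f : E → ℝ} {g x y : E}
    (hf : HasGradientAt f g x)
    (hchord : ∀ l ∈ Icc (0 : ℝ) 1, f (l • y + (1 - l) • x) ≤ l * f y + (1 - l) * f x) :
    ⟪g, y - x⟫ ≤ f y - f x := by
  have hline : HasDerivAt (fun l : ℝ => x + l • (y - x)) (y - x) 0 := by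
    simpa using ((hasDerivAt_id (0 : ℝ)).smul_const (y - x)).const_add x
  have hcomp : HasDerivAt (fun l : ℝ => f (x + l • (y - x))) ⟪g, y - x⟫ 0 := by
    have hf0 : HasFDerivAt f (InnerProductSpace.toDual ℝ E g) (x + (0 : ℝ) • (y - x)) := by
      simpa using hf.hasFDerivAt
    exact hf0.comp_hasDerivAt (0 : ℝ) hline
  refine le_of_tendsto hcomp.tendsto_slope_zero_right ?_
  filter_upwards [Ioc_mem_nhdsGT (zero_lt_one' ℝ)] with l hl
  have hpt : x + l • (y - x) = l • y + (1 - l) • x := by module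
  have hle := hchord l ⟨hl.1.le, hl.2⟩
  simp only [zero_add, zero_smul, add_zero, smul_eq_mul]
  rw [inv_mul_le_iff₀ hl.1, hpt]
  linarith

/-- A nonnegative sequence with `d (k + 1) ≤ d k - a * d k ^ 2` decays at least like
`1 / (a * k)`. -/
theorem mul_natCast_mul_le_one_of_quadratic_decrease {d : ℕ → ℝ} {a : ℝ} (ha : 0 ≤ a)
    (hd : ∀ k, 0 ≤ d k) (hstep : ∀ k, d (k + 1) ≤ d k - a * d k ^ 2) (k : ℕ) :
    a * k * d k ≤ 1 := by
  induction k with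
  | zero => simp
  | succ k ih =>
    have hk : (0 : ℝ) ≤ k := k.cast_nonneg
    set t := a * d k with ht
    have ht0 : 0 ≤ t := mul_nonneg ha (hd k)
    have hkt : k * t ≤ 1 := by rw [ht]; linarith
    have hnext : a * d (k + 1) ≤ t - t ^ 2 := by
      calc a * d (k + 1) ≤ a * (d k - a * d k ^ 2) := mul_le_mul_of_nonneg_left (hstep k) ha
        _ = t - t ^ 2 := by rw [ht]; ring
    have ht1 : t ≤ 1 := by
      have := mul_nonneg ha (hd (k + 1))
      nlinarith
    have hmul : (k + 1 : ℝ) * (a * d (k + 1)) ≤ (k + 1) * (t - t ^ 2) :=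
      mul_le_mul_of_nonneg_left hnext (by positivity)
    have hbound := mul_le_mul_of_nonneg_right hkt (sub_nonneg.2 ht1)
    push_cast
    nlinarith

/-- Iteration-complexity of the Frank–Wolfe algorithm with the Armijo stepsize
for a star-convex objective: `f(x^k) − f* ≤ 1/(ζ γ k)` for all `k ≥ 1`. -/
theorem frank_wolfe_armijo_rate {n : ℕ}
    (C : Set (EuclideanSpace ℝ (Fin n)))
    (hCne : C.Nonempty) (hCcpt : IsCompact C) (hCcvx : Convex ℝ C)
    (f : EuclideanSpace ℝ (Fin n) → ℝ)
    (f' : EuclideanSpace ℝ (Fin n) → EuclideanSpace ℝ (Fin n))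
    (hf : ∀ x, HasGradientAt f (f' x) x)
    (L : ℝ) (hL : 0 < L)
    (hLip : ∀ x ∈ C, ∀ y ∈ C, ‖f' x - f' y‖ ≤ L * ‖x - y‖)
    (fstar : ℝ) (hfstar : IsLeast (f '' C) fstar)
    (hstar : ∀ xs ∈ C, (∀ y ∈ C, f xs ≤ f y) → ∀ x ∈ C, ∀ l ∈ Icc (0 : ℝ) 1,
      f (l • xs + (1 - l) • x) ≤ l * f xs + (1 - l) * f x)
    (ρ : ℝ) (hρ : IsLUB ((fun x => ‖f' x‖) '' C) ρ)
    (ζ β : ℝ) (hζ : ζ ∈ Ioo (0 : ℝ) 1) (hβ : β ∈ Ioo (0 : ℝ) 1)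
    (γ : ℝ)
    (hγ : γ = min (1 / (ρ * diam C)) (2 * (1 - ζ) / (β * L * diam C ^ 2)))
    (x p : ℕ → EuclideanSpace ℝ (Fin n)) (lam : ℕ → ℝ) (ω : ℕ → ℝ)
    (hx : ∀ k, x k ∈ C) (hp : ∀ k, p k ∈ C)
    (hpmin : ∀ k, ∀ u ∈ C, ⟪f' (x k), p k - x k⟫ ≤ ⟪f' (x k), u - x k⟫)
    (hωdef : ∀ k, ω k = ⟪f' (x k), p k - x k⟫) (hω : ∀ k, ω k < 0)
    (hlam : ∀ k, lam k ∈ Ioc (0 : ℝ) 1)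
    (hiter : ∀ k, x (k + 1) = x k + lam k • (p k - x k))
    (hdescent : ∀ k, f (x (k + 1)) ≤ f (x k) - ζ * lam k * |ω k|)
    (hlamlb : ∀ k, lam k ≥ γ * |ω k|) :
    ∀ k : ℕ, 1 ≤ k → f (x k) - fstar ≤ 1 / (ζ * γ * (k : ℝ)) := by
  obtain ⟨xs, hxs, rfl⟩ := hfstar.1
  have hmin : ∀ y ∈ C, f xs ≤ f y := fun y hy => hfstar.2 (mem_image_of_mem f hy)
  have hgap : ∀ k, f (x k) - f xs ≤ |ω k| := fun k => by
    have hgrad := inner_gradient_le_sub_of_le_chord (hf (x k)) (hstar xs hxs hmin (x k) (hx k))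
    have hopt := hpmin k xs hxs
    rw [abs_of_neg (hω k), hωdef k]
    linarith
  have hinner : ⟪f' (x 0), p 0 - x 0⟫ ≠ 0 := hωdef 0 ▸ (hω 0).ne
  have hgrad0 : f' (x 0) ≠ 0 := fun h => hinner (by simp [h])
  have hdir0 : p 0 ≠ x 0 := fun h => hinner (by simp [h])
  have hρpos : 0 < ρ := (norm_pos_iff.2 hgrad0).trans_le (hρ.1 ⟨x 0, hx 0, rfl⟩)
  have hdiam : 0 < diam C :=
    (dist_pos.2 hdir0).trans_le (dist_le_diam_of_mem hCcpt.isBounded (hp 0) (hx 0))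
  have hγpos : 0 < γ := by
    have := sub_pos.2 hζ.2
    have := hβ.1
    rw [hγ]
    exact lt_min (by positivity) (by positivity)
  have hapos : 0 < ζ * γ := mul_pos hζ.1 hγpos
  have hnonneg : ∀ k, 0 ≤ f (x k) - f xs := fun k => sub_nonneg.2 (hmin _ (hx k))
  have hstep : ∀ k, f (x (k + 1)) - f xs ≤
      (f (x k) - f xs) - ζ * γ * (f (x k) - f xs) ^ 2 := fun k => by
    have hsq : (f (x k) - f xs) ^ 2 ≤ |ω k| ^ 2 := pow_le_pow_left₀ (hnonneg k) (hgap k) 2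
    have hdecr : ζ * γ * |ω k| ^ 2 ≤ ζ * lam k * |ω k| := by
      calc ζ * γ * |ω k| ^ 2 = ζ * (γ * |ω k|) * |ω k| := by ring
        _ ≤ ζ * lam k * |ω k| := mul_le_mul_of_nonneg_right
          (mul_le_mul_of_nonneg_left (hlamlb k) hζ.1.le) (abs_nonneg _)
    linarith [hdescent k, mul_le_mul_of_nonneg_left hsq hapos.le]
  intro k hk
  have hkpos : (0 : ℝ) < k := by exact_mod_cast hk
  rw [le_div_iff₀ (mul_pos hapos hkpos), mul_comm]
  exact mul_natCast_mul_le_one_of_quadratic_decrease hapos.le hnonneg hstep k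
end

section
/- Let C ⊆ ℝⁿ be a nonempty compact convex set, let f : ℝⁿ → ℝ be differentiable with ∇f L-Lipschitz continuous on C, let x ∈ C, let p ∈ C minimize u ↦ ∇f(x)ᵀ(u − x) over C, and set ω := ∇f(x)ᵀ(p − x) with ω < 0. If M ≥ L and λ := min{1, |ω|/(M·‖p − x‖²)}, then f(x + λ(p − x)) ≤ f(x) − |ω|·λ + (M/2)·‖p − x‖²·λ². In particular, the backtracking test of the Lipschitz-based adaptive stepsize rule is satisfied whenever the current estimate of the Lipschitz constant is at least L. -/
open Set
open scoped RealInnerProductSpace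

/-- The descent lemma on a convex set: a function whose gradient is `L`-Lipschitz on `C` is bounded
above on `C` by its quadratic model at any point of `C`. -/
theorem Convex.le_quadratic_model_of_lipschitz_gradient {E : Type*} [NormedAddCommGroup E]
    [InnerProductSpace ℝ E] [CompleteSpace E] {C : Set E} (hC : Convex ℝ C) {f : E → ℝ}
    {f' : E → E} (hf : ∀ x ∈ C, HasGradientAt f (f' x) x) {L : ℝ}
    (hLip : ∀ x ∈ C, ∀ y ∈ C, ‖f' x - f' y‖ ≤ L * ‖x - y‖) {x y : E} (hx : x ∈ C) (hy : y ∈ C) :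
    f y ≤ f x + ⟪f' x, y - x⟫ + L / 2 * ‖y - x‖ ^ 2 := by
  set v := y - x with hv
  have hmem : ∀ t ∈ Icc (0 : ℝ) 1, x + t • v ∈ C := fun t ht => hC.add_smul_sub_mem hx hy ht
  have hderiv : ∀ t ∈ Icc (0 : ℝ) 1,
      HasDerivAt (fun s : ℝ => f (x + s • v) - s * ⟪f' x, v⟫ - L / 2 * ‖v‖ ^ 2 * s ^ 2)
        (⟪f' (x + t • v), v⟫ - ⟪f' x, v⟫ - L * ‖v‖ ^ 2 * t) t := by
    intro t ht
    have hline : HasDerivAt (fun s : ℝ => x + s • v) v t := by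
      simpa using ((hasDerivAt_id t).smul_const v).const_add x
    have hcomp : HasDerivAt (fun s : ℝ => f (x + s • v)) ⟪f' (x + t • v), v⟫ t := by
      simpa [Function.comp_def] using
        (hf _ (hmem t ht)).hasFDerivAt.comp_hasDerivAt t hline
    have hlin : HasDerivAt (fun s : ℝ => s * ⟪f' x, v⟫) ⟪f' x, v⟫ t := by
      simpa using (hasDerivAt_id t).mul_const ⟪f' x, v⟫
    have hquad : HasDerivAt (fun s : ℝ => L / 2 * ‖v‖ ^ 2 * s ^ 2) (L * ‖v‖ ^ 2 * t) t := by
      refine ((hasDerivAt_pow 2 t).const_mul (L / 2 * ‖v‖ ^ 2)).congr_deriv ?_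
      push_cast
      ring
    exact (hcomp.sub hlin).sub hquad
  have hanti : AntitoneOn
      (fun s : ℝ => f (x + s • v) - s * ⟪f' x, v⟫ - L / 2 * ‖v‖ ^ 2 * s ^ 2) (Icc 0 1) := by
    refine antitoneOn_of_deriv_nonpos (convex_Icc 0 1)
      (fun t ht => (hderiv t ht).continuousAt.continuousWithinAt)
      (fun t ht => (hderiv t (interior_subset ht)).differentiableAt.differentiableWithinAt)
      fun t ht => ?_
    have ht' := interior_subset ht
    rw [(hderiv t ht').deriv, ← inner_sub_left, sub_nonpos]
    calc ⟪f' (x + t • v) - f' x, v⟫ ≤ ‖f' (x + t • v) - f' x‖ * ‖v‖ := real_inner_le_norm _ _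
      _ ≤ L * ‖x + t • v - x‖ * ‖v‖ := by
        gcongr
        exact hLip _ (hmem t ht') _ hx
      _ = L * ‖v‖ ^ 2 * t := by
        rw [add_sub_cancel_left, norm_smul, Real.norm_of_nonneg ht'.1]
        ring
  have hends := hanti (left_mem_Icc.2 zero_le_one) (right_mem_Icc.2 zero_le_one) zero_le_one
  have hxv : x + v = y := add_sub_cancel x y
  simp only [one_smul, zero_smul, hxv, add_zero] at hends
  linarith

/-- The backtracking test of the Lipschitz-based adaptive stepsize rule is
satisfied whenever the current Lipschitz-constant estimate `M` is at least the
true Lipschitz constant `L` of the gradient on `C`. -/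
theorem adaptive_test_holds_for_large_constant {n : ℕ}
    (C : Set (EuclideanSpace ℝ (Fin n)))
    (hCne : C.Nonempty) (hCcpt : IsCompact C) (hCcvx : Convex ℝ C)
    (f : EuclideanSpace ℝ (Fin n) → ℝ)
    (f' : EuclideanSpace ℝ (Fin n) → EuclideanSpace ℝ (Fin n))
    (hf : ∀ x, HasGradientAt f (f' x) x)
    (L : ℝ) (hL : 0 < L)
    (hLip : ∀ x ∈ C, ∀ y ∈ C, ‖f' x - f' y‖ ≤ L * ‖x - y‖)
    (x : EuclideanSpace ℝ (Fin n)) (hx : x ∈ C)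
    (p : EuclideanSpace ℝ (Fin n)) (hp : p ∈ C)
    (hpmin : ∀ u ∈ C, ⟪f' x, p - x⟫ ≤ ⟪f' x, u - x⟫)
    (ω : ℝ) (hωdef : ω = ⟪f' x, p - x⟫) (hω : ω < 0)
    (M : ℝ) (hM : L ≤ M)
    (lam : ℝ) (hlamdef : lam = min 1 (|ω| / (M * ‖p - x‖ ^ 2))) :
    f (x + lam • (p - x)) ≤ f x - |ω| * lam + (M / 2) * ‖p - x‖ ^ 2 * lam ^ 2 := by
  have hlam : lam ∈ Icc (0 : ℝ) 1 := by
    have hM0 : 0 ≤ M := hL.le.trans hM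
    rw [hlamdef]
    exact ⟨by positivity, min_le_left _ _⟩
  have h := hCcvx.le_quadratic_model_of_lipschitz_gradient (fun z _ => hf z) hLip hx
    (hCcvx.add_smul_sub_mem hx hp hlam)
  rw [add_sub_cancel_left, inner_smul_right, ← hωdef, norm_smul, Real.norm_of_nonneg hlam.1] at h
  rw [abs_of_neg hω]
  have hLM : L / 2 * (lam * ‖p - x‖) ^ 2 ≤ M / 2 * (lam * ‖p - x‖) ^ 2 := by gcongr
  linarith
end

section
/- Let C ⊆ ℝⁿ be a nonempty compact convex set, let f : ℝⁿ → ℝ be differentiable with ∇f L-Lipschitz continuous on C, let x ∈ C, let p ∈ C minimize u ↦ ∇f(x)ᵀ(u − x) over C, and set ω := ∇f(x)ᵀ(p − x) with ω < 0. Define the Lipschitz-based stepsize λ := min{1, |ω|/(L·‖p − x‖²)}, which is the minimizer over (0,1] of the function λ ↦ −|ω|·λ + (L/2)·‖p − x‖²·λ². Then for every β ∈ (0,1], f(x + λ(p − x)) ≤ f(x) − |ω|·β + (L/2)·‖p − x‖²·β². -/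
open Set
open scoped RealInnerProductSpace

/-- The truncated vertex `min 1 (a / K)` minimizes `t ↦ -a t + (K / 2) t ^ 2` over `t ≤ 1`. -/
theorem quadratic_min_one_div_le {a K t : ℝ} (hK : 0 < K) (ht : t ≤ 1) :
    -a * min 1 (a / K) + K / 2 * min 1 (a / K) ^ 2 ≤ -a * t + K / 2 * t ^ 2 := by
  rcases le_total 1 (a / K) with h | h
  · rw [min_eq_left h]
    rw [le_div_iff₀ hK, one_mul] at h
    nlinarith [mul_nonneg (sub_nonneg.2 ht) (sub_nonneg.2 h),
      mul_nonneg hK.le (sq_nonneg (1 - t))]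
  · rw [min_eq_right h]
    have ha : a = K * (a / K) := by field_simp
    generalize a / K = m at ha
    subst ha
    nlinarith [mul_nonneg hK.le (sq_nonneg (t - m))]

/-- The descent lemma along a segment of a convex set on which the gradient is Lipschitz. -/
theorem Convex.descent_lemma {E : Type*} [NormedAddCommGroup E] [InnerProductSpace ℝ E]
    [CompleteSpace E] {C : Set E} (hC : Convex ℝ C) {f : E → ℝ} {f' : E → E}
    (hf : ∀ x ∈ C, HasGradientAt f (f' x) x) {L : ℝ}
    (hLip : ∀ x ∈ C, ∀ y ∈ C, ‖f' x - f' y‖ ≤ L * ‖x - y‖)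
    {x p : E} (hx : x ∈ C) (hp : p ∈ C) {t : ℝ} (ht : t ∈ Icc (0 : ℝ) 1) :
    f (x + t • (p - x)) ≤ f x + ⟪f' x, p - x⟫ * t + L / 2 * ‖p - x‖ ^ 2 * t ^ 2 := by
  have hmem : ∀ s ∈ Icc (0 : ℝ) 1, x + s • (p - x) ∈ C := fun s hs =>
    hC.add_smul_sub_mem hx hp hs
  have hderiv : ∀ s ∈ Icc (0 : ℝ) 1,
      HasDerivAt (fun s : ℝ => f (x + s • (p - x))) ⟪f' (x + s • (p - x)), p - x⟫ s := by
    intro s hs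
    have hline : HasDerivAt (fun s : ℝ => x + s • (p - x)) (p - x) s := by
      simpa using ((hasDerivAt_id s).smul_const (p - x)).const_add x
    simpa [Function.comp_def] using (hf _ (hmem s hs)).hasFDerivAt.comp_hasDerivAt s hline
  have hquad : ∀ s : ℝ,
      HasDerivAt (fun s : ℝ => f x + ⟪f' x, p - x⟫ * s + L / 2 * ‖p - x‖ ^ 2 * s ^ 2)
        (⟪f' x, p - x⟫ + L * ‖p - x‖ ^ 2 * s) s := by
    intro s
    refine ((((hasDerivAt_id s).const_mul ⟪f' x, p - x⟫).const_add (f x)).add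
      ((hasDerivAt_pow 2 s).const_mul (L / 2 * ‖p - x‖ ^ 2))).congr_deriv ?_
    norm_num
    ring
  refine image_le_of_deriv_right_le_deriv_boundary
    (fun s hs => (hderiv s hs).continuousAt.continuousWithinAt)
    (fun s hs => (hderiv s (Ico_subset_Icc_self hs)).hasDerivWithinAt) (by simp)
    (fun s _ => (hquad s).continuousAt.continuousWithinAt)
    (fun s _ => (hquad s).hasDerivWithinAt) (fun s hs => ?_) ht
  have hnorm : ‖f' (x + s • (p - x)) - f' x‖ ≤ L * (s * ‖p - x‖) := by
    simpa [norm_smul, abs_of_nonneg hs.1] using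
      hLip _ (hmem s (Ico_subset_Icc_self hs)) x hx
  have hinner := (real_inner_le_norm (f' (x + s • (p - x)) - f' x) (p - x)).trans
    (mul_le_mul_of_nonneg_right hnorm (norm_nonneg _))
  rw [inner_sub_left] at hinner
  linarith

/-- With the Lipschitz-based stepsize `λ = min{1, |ω|/(L ‖p − x‖²)}`, which
minimizes `λ ↦ −|ω| λ + (L/2) ‖p − x‖² λ²` over `(0,1]`, we have
`f(x + λ(p − x)) ≤ f(x) − |ω| β + (L/2) ‖p − x‖² β²` for every `β ∈ (0,1]`. -/
theorem lipschitz_stepsize_key_inequality {n : ℕ}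
    (C : Set (EuclideanSpace ℝ (Fin n)))
    (hCne : C.Nonempty) (hCcpt : IsCompact C) (hCcvx : Convex ℝ C)
    (f : EuclideanSpace ℝ (Fin n) → ℝ)
    (f' : EuclideanSpace ℝ (Fin n) → EuclideanSpace ℝ (Fin n))
    (hf : ∀ x, HasGradientAt f (f' x) x)
    (L : ℝ) (hL : 0 < L)
    (hLip : ∀ x ∈ C, ∀ y ∈ C, ‖f' x - f' y‖ ≤ L * ‖x - y‖)
    (x : EuclideanSpace ℝ (Fin n)) (hx : x ∈ C)
    (p : EuclideanSpace ℝ (Fin n)) (hp : p ∈ C)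
    (hpmin : ∀ u ∈ C, ⟪f' x, p - x⟫ ≤ ⟪f' x, u - x⟫)
    (ω : ℝ) (hωdef : ω = ⟪f' x, p - x⟫) (hω : ω < 0)
    (lam : ℝ) (hlamdef : lam = min 1 (|ω| / (L * ‖p - x‖ ^ 2))) :
    (∀ t ∈ Ioc (0 : ℝ) 1,
      -|ω| * lam + (L / 2) * ‖p - x‖ ^ 2 * lam ^ 2 ≤
        -|ω| * t + (L / 2) * ‖p - x‖ ^ 2 * t ^ 2) ∧
    (∀ β ∈ Ioc (0 : ℝ) 1,
      f (x + lam • (p - x)) ≤ f x - |ω| * β + (L / 2) * ‖p - x‖ ^ 2 * β ^ 2) := by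
  have hpx : 0 < ‖p - x‖ := by
    refine norm_pos_iff.2 fun h => ?_
    simp [hωdef, h] at hω
  have hK : 0 < L * ‖p - x‖ ^ 2 := by positivity
  have hmin : ∀ t ∈ Ioc (0 : ℝ) 1,
      -|ω| * lam + (L / 2) * ‖p - x‖ ^ 2 * lam ^ 2 ≤
        -|ω| * t + (L / 2) * ‖p - x‖ ^ 2 * t ^ 2 := by
    intro t ht
    have h := quadratic_min_one_div_le (a := |ω|) hK ht.2
    rw [← hlamdef] at h
    linarith
  refine ⟨hmin, fun β hβ => ?_⟩
  have hlam : lam ∈ Icc (0 : ℝ) 1 := by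
    rw [hlamdef]
    exact ⟨le_min zero_le_one (by positivity), min_le_left _ _⟩
  have hdescent := hCcvx.descent_lemma (fun y _ => hf y) hLip hx hp hlam
  have hω_eq : ⟪f' x, p - x⟫ = -|ω| := by rw [abs_of_neg hω, neg_neg, hωdef]
  rw [hω_eq] at hdescent
  linarith [hmin β hβ]
end

section
/- Let C ⊆ ℝⁿ be a nonempty compact convex set with diameter diam(C), let f : ℝⁿ → ℝ be differentiable with ∇f L-Lipschitz continuous on C, and suppose f is star-convex on C with minimum value f*. Let {x^k} ⊆ C and {p^k} ⊆ C be sequences generated by the Frank–Wolfe algorithm with the diminishing stepsize rule: for each k, p^k minimizes u ↦ ∇f(x^k)ᵀ(u − x^k) over C, and x^{k+1} = x^k + β_k(p^k − x^k) with β_k = 2/(k+2). Then for every constant L₀ ≥ 0, f(x^k) − f* ≤ 4(L + L₀)·diam(C)²/k for all k = 1, 2, …. -/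
open Set Metric
open scoped RealInnerProductSpace

section

variable {E : Type*} [NormedAddCommGroup E] [InnerProductSpace ℝ E] [CompleteSpace E]

/-- First-order Taylor estimate on a convex set where the gradient is Lipschitz, with the
constant given by the mean value inequality. -/
theorem abs_sub_sub_inner_le_of_lipschitz_gradient {C : Set E} (hC : Convex ℝ C)
    {f : E → ℝ} {f' : E → E} (hf : ∀ x, HasGradientAt f (f' x) x) {L : ℝ} (hL : 0 ≤ L)
    (hLip : ∀ x ∈ C, ∀ y ∈ C, ‖f' x - f' y‖ ≤ L * ‖x - y‖) {x y : E} (hx : x ∈ C) (hy : y ∈ C) :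
    |f y - f x - ⟪f' x, y - x⟫| ≤ L * ‖y - x‖ ^ 2 := by
  have key := (convex_segment (𝕜 := ℝ) x y).norm_image_sub_le_of_norm_hasFDerivWithin_le'
    (f := f) (f' := fun z => InnerProductSpace.toDual ℝ E (f' z))
    (φ := InnerProductSpace.toDual ℝ E (f' x)) (C := L * ‖y - x‖)
    (fun z _ => (hf z).hasFDerivAt.hasFDerivWithinAt)
    (fun z hz => by
      rw [← map_sub, LinearIsometryEquiv.norm_map]
      refine (hLip z (hC.segment_subset hx hy hz) x hx).trans ?_
      gcongr
      obtain ⟨t, ht, rfl⟩ := (segment_eq_image' ℝ x y) ▸ hz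
      rw [add_sub_cancel_left, norm_smul, Real.norm_of_nonneg ht.1]
      exact mul_le_of_le_one_left (norm_nonneg _) ht.2)
    (left_mem_segment ℝ x y) (right_mem_segment ℝ x y)
  rw [Real.norm_eq_abs, InnerProductSpace.toDual_apply_apply] at key
  linarith

/-- Gradient inequality towards a centre of star-convexity. -/
theorem inner_gradient_le_of_starConvex {f : E → ℝ} {g x z : E} (hf : HasGradientAt f g x)
    (hstar : ∀ l ∈ Icc (0 : ℝ) 1, f (l • z + (1 - l) • x) ≤ l * f z + (1 - l) * f x) :
    ⟪g, z - x⟫ ≤ f z - f x := by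
  have hd : HasDerivAt (fun l : ℝ => f (x + l • (z - x))) ⟪g, z - x⟫ 0 := by
    have := hf.hasFDerivAt.hasLineDerivAt (z - x)
    rwa [HasLineDerivAt, InnerProductSpace.toDual_apply_apply] at this
  refine le_of_tendsto hd.tendsto_slope_zero_right ?_
  filter_upwards [Ioc_mem_nhdsGT (zero_lt_one' ℝ)] with l hl
  have h := hstar l ⟨hl.1.le, hl.2⟩
  have e : l • z + (1 - l) • x = x + l • (z - x) := by module
  rw [e] at h
  simp only [zero_add, zero_smul, add_zero, smul_eq_mul]
  rw [inv_mul_le_iff₀ hl.1]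
  linarith

end

/-- Rate of a sequence obeying the Frank–Wolfe recursion with stepsizes `2 / (k + 2)`. -/
theorem le_div_add_two_of_frank_wolfe_recursion {h : ℕ → ℝ} {M : ℝ} (hM : 0 ≤ M)
    (hrec : ∀ k : ℕ, h (k + 1) ≤
      (1 - 2 / ((k : ℝ) + 2)) * h k + M * (2 / ((k : ℝ) + 2)) ^ 2) (k : ℕ) :
    h (k + 1) ≤ 4 * M / ((k : ℝ) + 3) := by
  induction k with
  | zero =>
    have := hrec 0
    norm_num at this ⊢
    linarith
  | succ k ih =>
    have hk : (0 : ℝ) ≤ k := k.cast_nonneg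
    have hβ : 0 ≤ 1 - 2 / ((k : ℝ) + 1 + 2) := by
      rw [sub_nonneg, div_le_one (by positivity)]
      linarith
    have h1 := hrec (k + 1)
    push_cast at h1 ⊢
    refine h1.trans ((add_le_add_left (mul_le_mul_of_nonneg_left ih hβ) _).trans ?_)
    have e : 4 * M / ((k : ℝ) + 1 + 3) - ((1 - 2 / ((k : ℝ) + 1 + 2)) * (4 * M / ((k : ℝ) + 3))
        + M * (2 / ((k : ℝ) + 1 + 2)) ^ 2) = 4 * M / (((k : ℝ) + 4) * ((k : ℝ) + 3) ^ 2) := by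
      have : (k : ℝ) + 1 + 3 = k + 4 := by ring
      have : (k : ℝ) + 1 + 2 = k + 3 := by ring
      simp only [*]
      field_simp
      ring
    have : 0 ≤ 4 * M / (((k : ℝ) + 4) * ((k : ℝ) + 3) ^ 2) := by positivity
    linarith

/-- Iteration-complexity (function values) of the Frank–Wolfe algorithm with the
diminishing stepsize `β_k = 2/(k+2)` for a star-convex objective:
`f(x^k) − f* ≤ 4(L + L₀) diam(C)²/k` for all `k ≥ 1` and every `L₀ ≥ 0`. -/
theorem frank_wolfe_diminishing_rate_values {n : ℕ}
    (C : Set (EuclideanSpace ℝ (Fin n)))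
    (hCne : C.Nonempty) (hCcpt : IsCompact C) (hCcvx : Convex ℝ C)
    (f : EuclideanSpace ℝ (Fin n) → ℝ)
    (f' : EuclideanSpace ℝ (Fin n) → EuclideanSpace ℝ (Fin n))
    (hf : ∀ x, HasGradientAt f (f' x) x)
    (L : ℝ) (hL : 0 < L)
    (hLip : ∀ x ∈ C, ∀ y ∈ C, ‖f' x - f' y‖ ≤ L * ‖x - y‖)
    (fstar : ℝ) (hfstar : IsLeast (f '' C) fstar)
    (hstar : ∀ xs ∈ C, (∀ y ∈ C, f xs ≤ f y) → ∀ x ∈ C, ∀ l ∈ Icc (0 : ℝ) 1,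
      f (l • xs + (1 - l) • x) ≤ l * f xs + (1 - l) * f x)
    (x p : ℕ → EuclideanSpace ℝ (Fin n))
    (hx : ∀ k, x k ∈ C) (hp : ∀ k, p k ∈ C)
    (hpmin : ∀ k, ∀ u ∈ C, ⟪f' (x k), p k - x k⟫ ≤ ⟪f' (x k), u - x k⟫)
    (hiter : ∀ k : ℕ, x (k + 1) = x k + (2 / ((k : ℝ) + 2)) • (p k - x k)) :
    ∀ L₀ : ℝ, 0 ≤ L₀ → ∀ k : ℕ, 1 ≤ k →
      f (x k) - fstar ≤ 4 * (L + L₀) * diam C ^ 2 / (k : ℝ) := by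
  intro L₀ hL₀ k hk
  obtain ⟨⟨z, hz, rfl⟩, hmin⟩ := hfstar
  have hrec : ∀ k : ℕ, f (x (k + 1)) - f z ≤
      (1 - 2 / ((k : ℝ) + 2)) * (f (x k) - f z) + L * diam C ^ 2 * (2 / ((k : ℝ) + 2)) ^ 2 := by
    intro k
    have hβ : 0 ≤ 2 / ((k : ℝ) + 2) := by positivity
    have htaylor := (abs_le.1 (abs_sub_sub_inner_le_of_lipschitz_gradient hCcvx hf hL.le hLip
      (hx k) (hx (k + 1)))).2
    have hgap := (hpmin k z hz).trans (inner_gradient_le_of_starConvex (hf (x k))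
      (hstar z hz (fun y hy => hmin (mem_image_of_mem f hy)) (x k) (hx k)))
    have hdiam : ‖p k - x k‖ ≤ diam C := by
      rw [← dist_eq_norm]
      exact dist_le_diam_of_mem hCcpt.isBounded (hp k) (hx k)
    have hstep : x (k + 1) - x k = (2 / ((k : ℝ) + 2)) • (p k - x k) := by
      rw [hiter k, add_sub_cancel_left]
    rw [hstep, inner_smul_right, norm_smul, Real.norm_of_nonneg hβ, mul_pow] at htaylor
    have hquad : L * ((2 / ((k : ℝ) + 2)) ^ 2 * ‖p k - x k‖ ^ 2) ≤
        L * ((2 / ((k : ℝ) + 2)) ^ 2 * diam C ^ 2) := by gcongr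
    have hlin := mul_le_mul_of_nonneg_left hgap hβ
    linarith
  obtain ⟨m, rfl⟩ := Nat.exists_eq_add_of_le' hk
  refine (le_div_add_two_of_frank_wolfe_recursion (h := fun k => f (x k) - f z)
    (by positivity) hrec m).trans ?_
  rw [← mul_assoc]
  push_cast
  gcongr <;> linarith
end

section
/- Let C ⊆ ℝⁿ be a nonempty compact convex set with diameter diam(C), let f : ℝⁿ → ℝ be differentiable with ∇f L-Lipschitz continuous on C, and suppose f is star-convex on C with minimum value f*. Let {x^k} ⊆ C and {p^k} ⊆ C be sequences generated by the Frank–Wolfe algorithm with the Lipschitz-based stepsize rule: for each k, p^k minimizes u ↦ ∇f(x^k)ᵀ(u − x^k) over C with optimal value ω_k := ∇f(x^k)ᵀ(p^k − x^k) < 0, and x^{k+1} = x^k + λ_k(p^k − x^k) with λ_k = min{1, |ω_k|/(L·‖p^k − x^k‖²)}. Then for every constant L₀ ≥ 0, f(x^k) − f* ≤ 4(L + L₀)·diam(C)²/k for all k = 1, 2, …. -/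
open Set Metric
open scoped RealInnerProductSpace

section

variable {E : Type*} [NormedAddCommGroup E] [InnerProductSpace ℝ E] [CompleteSpace E]

/-- The derivative of a function along a line, in terms of its gradient. -/
lemma HasGradientAt.hasDerivAt_comp_add_smul {f : E → ℝ} {g x v : E} {t : ℝ}
    (hf : HasGradientAt f g (x + t • v)) :
    HasDerivAt (fun s : ℝ => f (x + s • v)) ⟪g, v⟫ t := by
  have hline : HasDerivAt (fun s : ℝ => x + s • v) v t := by
    simpa using ((hasDerivAt_id t).smul_const v).const_add x
  simpa [Function.comp_def] using hf.hasFDerivAt.comp_hasDerivAt t hline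

/-- Quadratic upper bound for a function whose gradient is Lipschitz on a convex set. -/
lemma Convex.le_add_inner_add_sq_of_lipschitz_gradient {C : Set E} (hC : Convex ℝ C)
    {f : E → ℝ} {f' : E → E} (hf : ∀ x ∈ C, HasGradientAt f (f' x) x) {L : ℝ}
    (hLip : ∀ x ∈ C, ∀ y ∈ C, ‖f' x - f' y‖ ≤ L * ‖x - y‖) {x y : E} (hx : x ∈ C) (hy : y ∈ C) :
    f y ≤ f x + ⟪f' x, y - x⟫ + L / 2 * ‖y - x‖ ^ 2 := by
  set v := y - x with hv
  have hmem : ∀ t ∈ Icc (0 : ℝ) 1, x + t • v ∈ C := fun t ht =>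
    hC.add_smul_sub_mem hx hy ht
  have hderiv : ∀ t ∈ Icc (0 : ℝ) 1,
      HasDerivAt (fun s : ℝ => f (x + s • v) - (s * ⟪f' x, v⟫ + L / 2 * ‖v‖ ^ 2 * s ^ 2))
        (⟪f' (x + t • v), v⟫ - (⟪f' x, v⟫ + L * ‖v‖ ^ 2 * t)) t := by
    intro t ht
    have hq : HasDerivAt (fun s : ℝ => s * ⟪f' x, v⟫ + L / 2 * ‖v‖ ^ 2 * s ^ 2)
        (⟪f' x, v⟫ + L * ‖v‖ ^ 2 * t) t := by
      refine (((hasDerivAt_id' t).mul_const ⟪f' x, v⟫).fun_add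
        ((hasDerivAt_pow 2 t).const_mul (L / 2 * ‖v‖ ^ 2))).congr_deriv ?_
      push_cast
      ring
    exact (hf _ (hmem t ht)).hasDerivAt_comp_add_smul.sub hq
  have hanti : AntitoneOn
      (fun s : ℝ => f (x + s • v) - (s * ⟪f' x, v⟫ + L / 2 * ‖v‖ ^ 2 * s ^ 2)) (Icc 0 1) := by
    refine antitoneOn_of_deriv_nonpos (convex_Icc 0 1)
      (fun t ht => (hderiv t ht).continuousAt.continuousWithinAt)
      (fun t ht => (hderiv t (interior_subset ht)).differentiableAt.differentiableWithinAt) ?_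
    intro t ht
    have ht' := interior_subset ht
    rw [(hderiv t ht').deriv]
    have hsub : ⟪f' (x + t • v), v⟫ - ⟪f' x, v⟫ ≤ L * ‖v‖ ^ 2 * t := calc
      ⟪f' (x + t • v), v⟫ - ⟪f' x, v⟫ = ⟪f' (x + t • v) - f' x, v⟫ := (inner_sub_left ..).symm
      _ ≤ ‖f' (x + t • v) - f' x‖ * ‖v‖ := real_inner_le_norm _ _
      _ ≤ (L * ‖x + t • v - x‖) * ‖v‖ := by
        gcongr
        exact hLip _ (hmem t ht') _ hx
      _ = L * ‖v‖ ^ 2 * t := by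
        rw [add_sub_cancel_left, norm_smul, Real.norm_of_nonneg ht'.1]
        ring
    linarith
  have h01 := hanti (left_mem_Icc.2 zero_le_one) (right_mem_Icc.2 zero_le_one) zero_le_one
  simp only [one_smul, zero_smul, add_zero, hv, add_sub_cancel] at h01
  rw [← hv] at h01
  linarith

/-- A function lying below its chord from `x` to `y` has directional derivative at `x` at most
`f y - f x`. -/
lemma HasGradientAt.inner_sub_le_of_le_chord {f : E → ℝ} {g x y : E} (hf : HasGradientAt f g x)
    (hchord : ∀ t ∈ Icc (0 : ℝ) 1, f (t • y + (1 - t) • x) ≤ t * f y + (1 - t) * f x) :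
    ⟪g, y - x⟫ ≤ f y - f x := by
  have hderiv : HasDerivAt (fun s : ℝ => f (x + s • (y - x))) ⟪g, y - x⟫ 0 :=
    HasGradientAt.hasDerivAt_comp_add_smul (by simpa using hf)
  have hslope := (hasDerivWithinAt_iff_tendsto_slope' (s := Ioi 0) (by simp)).1
    hderiv.hasDerivWithinAt
  refine le_of_tendsto hslope ?_
  filter_upwards [Ioo_mem_nhdsGT (zero_lt_one (α := ℝ))] with t ht
  have hc := hchord t ⟨ht.1.le, ht.2.le⟩
  have hline : t • y + (1 - t) • x = x + t • (y - x) := by module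
  rw [hline] at hc
  rw [slope_def_field, div_le_iff₀ (by linarith [ht.1])]
  simp only [zero_smul, add_zero, sub_zero]
  linarith

end

/-- The truncated step `min 1 (w / q)` minimizes `s ↦ -s * w + q / 2 * s ^ 2` over `[0, 1]`. -/
lemma quadratic_min_step_le {w q t : ℝ} (hq : 0 < q) (ht : t ∈ Icc (0 : ℝ) 1) :
    -(min 1 (w / q)) * w + q / 2 * min 1 (w / q) ^ 2 ≤ -t * w + q / 2 * t ^ 2 := by
  rcases le_total 1 (w / q) with h | h
  · rw [min_eq_left h]
    rw [le_div_iff₀ hq] at h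
    nlinarith [mul_nonneg (sub_nonneg.2 ht.2) (sub_nonneg.2 h),
      mul_nonneg hq.le (sq_nonneg (1 - t))]
  · rw [min_eq_right h]
    obtain ⟨r, rfl⟩ : ∃ r, w = q * r := ⟨w / q, by field_simp⟩
    rw [mul_div_cancel_left₀ r hq.ne']
    nlinarith [mul_nonneg hq.le (sq_nonneg (t - r))]

/-- The recursion `δ (k + 1) ≤ (1 - t) * δ k + M / 2 * t ^ 2` for all `t ∈ [0, 1]` forces a
`1 / k` decay. -/
lemma le_div_of_forall_step_le {δ : ℕ → ℝ} {M : ℝ} (hM : 0 ≤ M)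
    (hstep : ∀ k, ∀ t ∈ Icc (0 : ℝ) 1, δ (k + 1) ≤ (1 - t) * δ k + M / 2 * t ^ 2)
    {k : ℕ} (hk : 1 ≤ k) : δ k ≤ 4 * M / k := by
  induction k, hk using Nat.le_induction with
  | base =>
    have h := hstep 0 1 (by simp)
    norm_num at h ⊢
    linarith
  | succ k hk ih =>
    have hk' : (1 : ℝ) ≤ k := by exact_mod_cast hk
    have hle : 2 / ((k : ℝ) + 1) ≤ 1 := by
      rw [div_le_one (by linarith)]
      linarith
    calc δ (k + 1) ≤ (1 - 2 / ((k : ℝ) + 1)) * δ k + M / 2 * (2 / ((k : ℝ) + 1)) ^ 2 :=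
          hstep k _ ⟨by positivity, hle⟩
      _ ≤ (1 - 2 / ((k : ℝ) + 1)) * (4 * M / k) + M / 2 * (2 / ((k : ℝ) + 1)) ^ 2 := by
          gcongr
      _ = 4 * M / ((k + 1 : ℕ) : ℝ) - M * (2 * k + 4) / (k * ((k : ℝ) + 1) ^ 2) := by
          push_cast
          field_simp
          ring
      _ ≤ 4 * M / ((k + 1 : ℕ) : ℝ) := sub_le_self _ (by positivity)

/-- Iteration-complexity (function values) of the Frank–Wolfe algorithm with the
Lipschitz-based stepsize `λ_k = min{1, |ω_k|/(L ‖p^k − x^k‖²)}` for a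
star-convex objective: `f(x^k) − f* ≤ 4(L + L₀) diam(C)²/k` for all `k ≥ 1`
and every `L₀ ≥ 0`. -/
theorem frank_wolfe_lipschitz_rate_values {n : ℕ}
    (C : Set (EuclideanSpace ℝ (Fin n)))
    (hCne : C.Nonempty) (hCcpt : IsCompact C) (hCcvx : Convex ℝ C)
    (f : EuclideanSpace ℝ (Fin n) → ℝ)
    (f' : EuclideanSpace ℝ (Fin n) → EuclideanSpace ℝ (Fin n))
    (hf : ∀ x, HasGradientAt f (f' x) x)
    (L : ℝ) (hL : 0 < L)
    (hLip : ∀ x ∈ C, ∀ y ∈ C, ‖f' x - f' y‖ ≤ L * ‖x - y‖)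
    (fstar : ℝ) (hfstar : IsLeast (f '' C) fstar)
    (hstar : ∀ xs ∈ C, (∀ y ∈ C, f xs ≤ f y) → ∀ x ∈ C, ∀ l ∈ Icc (0 : ℝ) 1,
      f (l • xs + (1 - l) • x) ≤ l * f xs + (1 - l) * f x)
    (x p : ℕ → EuclideanSpace ℝ (Fin n)) (ω : ℕ → ℝ) (lam : ℕ → ℝ)
    (hx : ∀ k, x k ∈ C) (hp : ∀ k, p k ∈ C)
    (hpmin : ∀ k, ∀ u ∈ C, ⟪f' (x k), p k - x k⟫ ≤ ⟪f' (x k), u - x k⟫)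
    (hωdef : ∀ k, ω k = ⟪f' (x k), p k - x k⟫) (hω : ∀ k, ω k < 0)
    (hlamdef : ∀ k, lam k = min 1 (|ω k| / (L * ‖p k - x k‖ ^ 2)))
    (hiter : ∀ k : ℕ, x (k + 1) = x k + lam k • (p k - x k)) :
    ∀ L₀ : ℝ, 0 ≤ L₀ → ∀ k : ℕ, 1 ≤ k →
      f (x k) - fstar ≤ 4 * (L + L₀) * diam C ^ 2 / (k : ℝ) := by
  intro L₀ hL₀ k hk
  obtain ⟨⟨xs, hxs, rfl⟩, hlow⟩ := hfstar
  have hmin : ∀ y ∈ C, f xs ≤ f y := fun y hy => hlow (mem_image_of_mem f hy)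
  have hstep : ∀ k, ∀ t ∈ Icc (0 : ℝ) 1,
      f (x (k + 1)) - f xs ≤ (1 - t) * (f (x k) - f xs) + L * diam C ^ 2 / 2 * t ^ 2 := by
    intro k t ht
    have hgap : ω k ≤ f xs - f (x k) := by
      rw [hωdef]
      exact (hpmin k xs hxs).trans
        ((hf (x k)).inner_sub_le_of_le_chord (hstar xs hxs hmin (x k) (hx k)))
    have hne : p k - x k ≠ 0 := by
      intro h
      have := hω k
      simp [hωdef, h] at this
    have hq : 0 < L * ‖p k - x k‖ ^ 2 := by positivity
    have hdesc := hCcvx.le_add_inner_add_sq_of_lipschitz_gradient (fun x _ => hf x) hLip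
      (hx k) (hx (k + 1))
    rw [hiter k, add_sub_cancel_left, inner_smul_right, ← hωdef, norm_smul, mul_pow,
      Real.norm_eq_abs, sq_abs, ← hiter k] at hdesc
    have hopt := quadratic_min_step_le (w := |ω k|) hq ht
    rw [← hlamdef, abs_of_neg (hω k)] at hopt
    have hdiam : ‖p k - x k‖ ≤ diam C := by
      rw [← dist_eq_norm]
      exact dist_le_diam_of_mem hCcpt.isBounded (hp k) (hx k)
    have hquad : L * ‖p k - x k‖ ^ 2 / 2 * t ^ 2 ≤ L * diam C ^ 2 / 2 * t ^ 2 := by gcongr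
    linarith [mul_le_mul_of_nonneg_left hgap ht.1]
  calc f (x k) - f xs ≤ 4 * (L * diam C ^ 2) / k :=
        le_div_of_forall_step_le (δ := fun k => f (x k) - f xs) (by positivity) hstep hk
    _ ≤ 4 * (L + L₀) * diam C ^ 2 / k := by
        rw [← mul_assoc]
        gcongr
        linarith
end
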